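/- Let α > 0. Then there exist constants δ > 0 and C > 0 such that the non-increasing rearrangement of the function x ↦ G^α_{1/2}(ρ(x)) on B⁴ with respect to hyperbolic volume satisfies [G^α_{1/2}(ρ(·))]*(t) ≤ C t^{−1−δ} for all t > 2. -/

import Mathlib

open MeasureTheory Real

noncomputable section

/-- The Euclidean space `ℝ⁴`. -/
abbrev E4 := EuclideanSpace ℝ (Fin 4)

/-- The hyperbolic volume measure on the Poincaré ball `B⁴`: Lebesgue measure restricted
to the unit ball, with density `(2/(1-|x|²))⁴`. -/
def hypVol : Measure E4 :=
  (volume.restrict (Metric.ball (0 : E4) 1)).withDensity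
    (fun x => ENNReal.ofReal ((2 / (1 - ‖x‖ ^ 2)) ^ 4))

/-- The hyperbolic distance from the origin in the Poincaré ball. -/
def rhyp (x : E4) : ℝ := Real.log ((1 + ‖x‖) / (1 - ‖x‖))

/-- The non-increasing rearrangement of a function on `B⁴` with respect to the
hyperbolic volume. -/
def rearr (f : E4 → ℝ) (t : ℝ) : ℝ :=
  sInf {s : ℝ | 0 < s ∧ hypVol {x : E4 | s < |f x|} ≤ ENNReal.ofReal t}

end

open MeasureTheory Real

noncomputable section

/-- The kernel of `(-Δ_ℍ + α)^{-1/2}` on 4-dimensional hyperbolic space, as a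
function of the geodesic distance `ρ`. -/
def Gahalf (α ρ : ℝ) : ℝ :=
  (1 / (2 * Real.sqrt π * (2 * π) ^ ((5 : ℝ) / 2))) *
      (∫ r in Set.Ioi ρ,
        ((r * Real.cosh r - Real.sinh r) /
            (Real.sinh r ^ 2 * Real.sqrt (Real.cosh r - Real.cosh ρ))) *
          ∫ t in Set.Ioi (0 : ℝ), t ^ (-2 : ℤ) * Real.exp (-(α + 9 / 4) * t - r ^ 2 / (4 * t)))
    + (1 / (4 * Real.sqrt π * (2 * π) ^ ((5 : ℝ) / 2))) *
      (∫ r in Set.Ioi ρ,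
        (r ^ 2 / (Real.sinh r * Real.sqrt (Real.cosh r - Real.cosh ρ))) *
          ∫ t in Set.Ioi (0 : ℝ), t ^ (-3 : ℤ) * Real.exp (-(α + 9 / 4) * t - r ^ 2 / (4 * t)))

end

/-- The subordination integral `∫ t⁻ⁿ exp(-a²t - r²/4t) dt` decays like `exp(-br)` for every
`b < a`. -/
lemma abs_integral_zpow_mul_exp_le (n : ℕ) {a b r₀ : ℝ} (hb : 0 < b) (hab : b < a) (hr₀ : 0 < r₀) :
    ∃ K : ℝ, 0 < K ∧ ∀ r, r₀ ≤ r →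
      |∫ t in Set.Ioi (0 : ℝ), t ^ (-(n : ℤ)) * Real.exp (-(a ^ 2) * t - r ^ 2 / (4 * t))|
        ≤ K * Real.exp (-b * r) := by
  have ha : 0 < a := hb.trans hab
  obtain ⟨θ, hθ, hθb⟩ : ∃ θ : ℝ, 0 < θ ∧ (1 - θ) * a = b :=
    ⟨1 - b / a, by rw [sub_pos, div_lt_one ha]; exact hab, by field_simp; ring⟩
  have hθ1 : 0 ≤ 1 - θ := by
    by_contra! h
    nlinarith
  set c := θ * r₀ ^ 2 / 4 with hc
  have hc0 : 0 < c := by positivity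
  have hneg : -(θ * a ^ 2) < 0 := by
    have : 0 < θ * a ^ 2 := by positivity
    linarith
  have hint := integrableOn_exp_mul_Ioi hneg 0
  refine ⟨n.factorial / c ^ n * (1 / (θ * a ^ 2)), by positivity, fun r hr => ?_⟩
  have hbound : ∀ t ∈ Set.Ioi (0 : ℝ),
      ‖t ^ (-(n : ℤ)) * Real.exp (-(a ^ 2) * t - r ^ 2 / (4 * t))‖
        ≤ n.factorial / c ^ n * Real.exp (-b * r) * Real.exp (-(θ * a ^ 2) * t) := by
    intro t (ht : 0 < t)
    rw [Real.norm_of_nonneg (by positivity), zpow_neg, zpow_natCast]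
    have hexp : -(a ^ 2) * t - r ^ 2 / (4 * t) ≤ -b * r + -(θ * a ^ 2) * t + -(c / t) := by
      have h1 : a * r ≤ a ^ 2 * t + r ^ 2 / (4 * t) := by
        have : a ^ 2 * t + r ^ 2 / (4 * t) - a * r = (2 * a * t - r) ^ 2 / (4 * t) := by
          field_simp; ring
        have h2 : 0 ≤ (2 * a * t - r) ^ 2 / (4 * t) := by positivity
        linarith
      have h3 := mul_le_mul_of_nonneg_left h1 hθ1
      have h4 : c / t ≤ θ * (r ^ 2 / (4 * t)) := by
        have : c / t = θ * (r₀ ^ 2 / (4 * t)) := by rw [hc]; field_simp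
        rw [this]
        gcongr
      have h5 : (1 - θ) * (a * r) = b * r := by rw [← hθb]; ring
      linarith
    have hfac : (t ^ n)⁻¹ * Real.exp (-(c / t)) ≤ n.factorial / c ^ n := by
      have h := Real.pow_div_factorial_le_exp (c / t) (by positivity) n
      rw [Real.exp_neg, ← mul_inv, le_div_iff₀ (by positivity), inv_mul_le_iff₀ (by positivity)]
      rw [div_pow, div_div, div_le_iff₀ (by positivity)] at h
      linarith
    calc (t ^ n)⁻¹ * Real.exp (-(a ^ 2) * t - r ^ 2 / (4 * t))
        ≤ (t ^ n)⁻¹ * Real.exp (-b * r + -(θ * a ^ 2) * t + -(c / t)) := by gcongr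
      _ = ((t ^ n)⁻¹ * Real.exp (-(c / t))) *
            (Real.exp (-b * r) * Real.exp (-(θ * a ^ 2) * t)) := by
          rw [Real.exp_add, Real.exp_add]; ring
      _ ≤ n.factorial / c ^ n * (Real.exp (-b * r) * Real.exp (-(θ * a ^ 2) * t)) := by gcongr
      _ = _ := by ring
  have h := norm_integral_le_of_norm_le (hint.const_mul (n.factorial / c ^ n * Real.exp (-b * r)))
    ((ae_restrict_iff' measurableSet_Ioi).2 (Filter.Eventually.of_forall hbound))
  rw [integral_const_mul, integral_exp_mul_Ioi hneg, Real.norm_eq_abs] at h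
  refine h.trans (le_of_eq ?_)
  rw [mul_zero, Real.exp_zero, neg_div_neg_eq]
  ring

lemma exists_mul_exp_le_sinh {r₀ : ℝ} (hr₀ : 0 < r₀) :
    ∃ c : ℝ, 0 < c ∧ ∀ r, r₀ ≤ r → c * Real.exp r ≤ Real.sinh r := by
  refine ⟨(1 - Real.exp (-(2 * r₀))) / 2, ?_, fun r hr => ?_⟩
  · have : Real.exp (-(2 * r₀)) < 1 := by
      rw [Real.exp_lt_one_iff]
      linarith
    linarith
  · have h : Real.exp (-r) ≤ Real.exp (-(2 * r₀)) * Real.exp r := by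
      rw [← Real.exp_add]
      exact Real.exp_le_exp.2 (by linarith)
    rw [Real.sinh_eq]
    linarith

lemma sub_mul_sinh_le_cosh_sub_cosh {ρ r : ℝ} (hρ : 0 ≤ ρ) (hr : ρ ≤ r) :
    (r - ρ) * Real.sinh ρ ≤ Real.cosh r - Real.cosh ρ := by
  have hsum : Real.cosh r - Real.cosh ρ
      = 2 * Real.sinh ((r - ρ) / 2) * Real.sinh ((r + ρ) / 2) := by
    have h1 := Real.cosh_add ((r + ρ) / 2) ((r - ρ) / 2)
    have h2 := Real.cosh_sub ((r + ρ) / 2) ((r - ρ) / 2)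
    rw [show (r + ρ) / 2 + (r - ρ) / 2 = r by ring] at h1
    rw [show (r + ρ) / 2 - (r - ρ) / 2 = ρ by ring] at h2
    rw [h1, h2]
    ring
  have h1 : (r - ρ) / 2 ≤ Real.sinh ((r - ρ) / 2) := Real.self_le_sinh_iff.2 (by linarith)
  have h2 : Real.sinh ρ ≤ Real.sinh ((r + ρ) / 2) := Real.sinh_le_sinh.2 (by linarith)
  have h3 : 0 ≤ Real.sinh ρ := Real.sinh_nonneg_iff.2 hρ
  rw [hsum]
  exact mul_le_mul (by linarith) h2 h3 (by linarith)

/-- Decay of Abel-type integrals with weight `1/√(cosh r - cosh ρ)`. -/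
lemma abs_integral_div_sqrt_cosh_sub_cosh_le {p r₀ : ℝ} (hp : 0 < p) (hr₀ : 0 < r₀) :
    ∃ M : ℝ, 0 < M ∧ ∀ (F : ℝ → ℝ) (K ρ : ℝ), 0 ≤ K → r₀ ≤ ρ →
      (∀ r, ρ < r → |F r| ≤ K * Real.exp (-p * r) / Real.sqrt (Real.cosh r - Real.cosh ρ)) →
      |∫ r in Set.Ioi ρ, F r| ≤ K * M * Real.exp (-(p + 1 / 2) * ρ) := by
  obtain ⟨c, hc, hsinh⟩ := exists_mul_exp_le_sinh hr₀
  have hgamma := Real.integral_rpow_mul_exp_neg_mul_Ioi (a := 1 / 2) (by norm_num) hp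
  have hG : 0 < (1 / p) ^ (1 / 2 : ℝ) * Real.Gamma (1 / 2) :=
    mul_pos (by positivity) (Real.Gamma_pos_of_pos (by norm_num))
  set I := (1 / p) ^ (1 / 2 : ℝ) * Real.Gamma (1 / 2) with hI
  have hint : IntegrableOn (fun t : ℝ => t ^ ((1 / 2 : ℝ) - 1) * Real.exp (-(p * t)))
      (Set.Ioi 0) := .of_integral_ne_zero (by rw [hgamma]; exact hG.ne')
  refine ⟨I / Real.sqrt c, by positivity, fun F K ρ hK hρ hF => ?_⟩
  have hmp : MeasurePreserving (fun r : ℝ => r - ρ) volume volume :=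
    measurePreserving_sub_right volume ρ
  have hemb : MeasurableEmbedding (fun r : ℝ => r - ρ) :=
    (MeasurableEquiv.subRight ρ).measurableEmbedding
  have hpre : (fun r : ℝ => r - ρ) ⁻¹' Set.Ioi 0 = Set.Ioi ρ := by
    ext r; simp
  have hint' := (hmp.integrableOn_comp_preimage hemb).2 hint
  have hval := hmp.setIntegral_preimage_emb hemb
    (fun t : ℝ => t ^ ((1 / 2 : ℝ) - 1) * Real.exp (-(p * t))) (Set.Ioi 0)
  rw [hpre] at hint' hval
  rw [hgamma] at hval
  set D := K * Real.exp (-(p + 1 / 2) * ρ) / Real.sqrt c with hD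
  have hbound : ∀ r ∈ Set.Ioi ρ, ‖F r‖ ≤
      D * ((r - ρ) ^ ((1 / 2 : ℝ) - 1) * Real.exp (-(p * (r - ρ)))) := by
    intro r (hr : ρ < r)
    have hs : 0 < r - ρ := sub_pos.2 hr
    refine (hF r hr).trans ?_
    have h1 : (r - ρ) * (c * Real.exp ρ) ≤ Real.cosh r - Real.cosh ρ :=
      (mul_le_mul_of_nonneg_left (hsinh ρ hρ) hs.le).trans
        (sub_mul_sinh_le_cosh_sub_cosh (hr₀.le.trans hρ) hr.le)
    have h2 : Real.sqrt (r - ρ) * (Real.sqrt c * Real.exp (ρ / 2))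
        ≤ Real.sqrt (Real.cosh r - Real.cosh ρ) := by
      refine le_trans (le_of_eq ?_) (Real.sqrt_le_sqrt h1)
      rw [Real.sqrt_mul hs.le, Real.sqrt_mul hc.le, Real.exp_half]
    have h3 : (r - ρ) ^ ((1 / 2 : ℝ) - 1) = (Real.sqrt (r - ρ))⁻¹ := by
      rw [Real.sqrt_eq_rpow, ← Real.rpow_neg hs.le]
      norm_num
    have hsq : 0 < Real.sqrt (r - ρ) := Real.sqrt_pos.2 hs
    have hcq : 0 < Real.sqrt c := Real.sqrt_pos.2 hc
    calc K * Real.exp (-p * r) / Real.sqrt (Real.cosh r - Real.cosh ρ)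
        ≤ K * Real.exp (-p * r) / (Real.sqrt (r - ρ) * (Real.sqrt c * Real.exp (ρ / 2))) := by
          gcongr
      _ = D * ((r - ρ) ^ ((1 / 2 : ℝ) - 1) * Real.exp (-(p * (r - ρ)))) := by
          have h4 : Real.exp (-p * r) = Real.exp (-(p + 1 / 2) * ρ) * Real.exp (-(p * (r - ρ))) *
              Real.exp (ρ / 2) := by
            rw [← Real.exp_add, ← Real.exp_add]
            congr 1
            ring
          rw [h3, hD, h4]
          field_simp
  have h := norm_integral_le_of_norm_le (hint'.const_mul D)
    ((ae_restrict_iff' measurableSet_Ioi).2 (Filter.Eventually.of_forall hbound))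
  simp only [Function.comp_def] at h
  rw [integral_const_mul, hval, Real.norm_eq_abs] at h
  refine h.trans (le_of_eq ?_)
  rw [hD]
  ring

lemma sq_le_mul_exp {η r : ℝ} (hη : 0 < η) (hr : 0 ≤ r) :
    r ^ 2 ≤ 2 / η ^ 2 * Real.exp (η * r) := by
  have h := Real.pow_div_factorial_le_exp (η * r) (by positivity) 2
  rw [div_mul_eq_mul_div, le_div_iff₀ (by positivity)]
  norm_num at h
  linarith

lemma add_one_le_mul_exp {η r : ℝ} (hη : 0 < η) (hr : 0 ≤ r) :
    r + 1 ≤ (1 / η + 1) * Real.exp (η * r) := by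
  have h1 := Real.add_one_le_exp (η * r)
  have h2 : 1 ≤ Real.exp (η * r) := Real.one_le_exp (by positivity)
  have h3 : r ≤ 1 / η * Real.exp (η * r) := by
    rw [div_mul_eq_mul_div, le_div_iff₀ hη]
    linarith
  linarith

lemma cosh_le_exp {r : ℝ} (hr : 0 ≤ r) : Real.cosh r ≤ Real.exp r := by
  have : Real.exp (-r) ≤ Real.exp r := Real.exp_le_exp.2 (by linarith)
  rw [Real.cosh_eq]
  linarith

lemma sinh_le_exp (r : ℝ) : Real.sinh r ≤ Real.exp r := by
  have h1 := Real.exp_pos (-r)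
  have h2 := Real.exp_pos r
  rw [Real.sinh_eq]
  linarith

/-- Away from the origin the kernel decays strictly faster than the inverse volume. -/
lemma Gahalf_decay {α r₀ : ℝ} (hα : 0 < α) (hr₀ : 0 < r₀) :
    ∃ η K : ℝ, 0 < η ∧ 0 < K ∧ ∀ ρ, r₀ ≤ ρ → |Gahalf α ρ| ≤ K * Real.exp (-(3 + η) * ρ) := by
  have ha2 : Real.sqrt (α + 9 / 4) ^ 2 = α + 9 / 4 := Real.sq_sqrt (by positivity)
  have ha : 3 / 2 < Real.sqrt (α + 9 / 4) := Real.lt_sqrt_of_sq_lt (by linarith)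
  obtain ⟨η, hη, hηa⟩ : ∃ η : ℝ, 0 < η ∧ 3 / 2 + 2 * η < Real.sqrt (α + 9 / 4) :=
    ⟨(Real.sqrt (α + 9 / 4) - 3 / 2) / 4, by linarith, by linarith⟩
  obtain ⟨K₂, hK₂, hin₂⟩ := abs_integral_zpow_mul_exp_le 2 (by positivity) hηa hr₀
  obtain ⟨K₃, hK₃, hin₃⟩ := abs_integral_zpow_mul_exp_le 3 (by positivity) hηa hr₀
  rw [ha2] at hin₂ hin₃
  obtain ⟨c, hc, hsinh⟩ := exists_mul_exp_le_sinh hr₀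
  obtain ⟨M, hM, hout⟩ := abs_integral_div_sqrt_cosh_sub_cosh_le
    (show (0 : ℝ) < 5 / 2 + η by positivity) hr₀
  set A := 1 / (2 * Real.sqrt π * (2 * π) ^ ((5 : ℝ) / 2)) with hA
  set B := 1 / (4 * Real.sqrt π * (2 * π) ^ ((5 : ℝ) / 2)) with hB
  have hA0 : 0 < A := by positivity
  have hB0 : 0 < B := by positivity
  set L₂ := (1 / η + 1) / c ^ 2 * K₂ with hL₂
  set L₃ := 2 / η ^ 2 / c * K₃ with hL₃
  have hL₂0 : 0 < L₂ := by positivity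
  have hL₃0 : 0 < L₃ := by positivity
  refine ⟨η, A * (L₂ * M) + B * (L₃ * M), hη, by positivity, fun ρ hρ => ?_⟩
  have hρ0 : 0 < ρ := hr₀.trans_le hρ
  have hexp : Real.exp (-(5 / 2 + η + 1 / 2) * ρ) = Real.exp (-(3 + η) * ρ) := by
    congr 1; ring
  have h₂ := hout (fun r => ((r * Real.cosh r - Real.sinh r) /
      (Real.sinh r ^ 2 * Real.sqrt (Real.cosh r - Real.cosh ρ))) *
      ∫ t in Set.Ioi (0 : ℝ), t ^ (-2 : ℤ) * Real.exp (-(α + 9 / 4) * t - r ^ 2 / (4 * t)))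
    L₂ ρ hL₂0.le hρ (by
      intro r hr
      have hr0 : 0 < r := hρ0.trans hr
      have hcosh : 0 < Real.cosh r - Real.cosh ρ :=
        sub_pos.2 (Real.cosh_lt_cosh.2 (by rwa [abs_of_pos hρ0, abs_of_pos hr0]))
      have hsq := Real.sqrt_pos.2 hcosh
      have hs := hsinh r (hρ.trans hr.le)
      have hs0 : 0 < Real.sinh r := Real.sinh_pos_iff.2 hr0
      have hnum : |r * Real.cosh r - Real.sinh r|
          ≤ (1 / η + 1) * Real.exp (η * r) * Real.exp r := by
        have h1 := mul_le_mul_of_nonneg_left (cosh_le_exp hr0.le) hr0.le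
        have h2 := mul_le_mul_of_nonneg_right (add_one_le_mul_exp hη hr0.le) (Real.exp_pos r).le
        have h3 := sinh_le_exp r
        have h4 : 0 ≤ r * Real.cosh r := mul_nonneg hr0.le (Real.cosh_pos r).le
        rw [abs_le]
        constructor <;> nlinarith [Real.exp_pos r]
      rw [abs_mul, abs_div, abs_of_pos (mul_pos (pow_pos hs0 2) hsq)]
      calc |r * Real.cosh r - Real.sinh r| /
            (Real.sinh r ^ 2 * Real.sqrt (Real.cosh r - Real.cosh ρ)) * _
          ≤ (1 / η + 1) * Real.exp (η * r) * Real.exp r /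
            ((c * Real.exp r) ^ 2 * Real.sqrt (Real.cosh r - Real.cosh ρ)) *
            (K₂ * Real.exp (-(3 / 2 + 2 * η) * r)) := by
            have := hin₂ r (hρ.trans hr.le)
            gcongr
            exact this
        _ = L₂ * Real.exp (-(5 / 2 + η) * r) / Real.sqrt (Real.cosh r - Real.cosh ρ) := by
            have h1 : Real.exp (-(5 / 2 + η) * r) * Real.exp r =
                Real.exp (η * r) * Real.exp (-(3 / 2 + 2 * η) * r) := by
              rw [← Real.exp_add, ← Real.exp_add]
              congr 1
              ring
            generalize Real.exp (-(5 / 2 + η) * r) = x at h1 ⊢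
            generalize Real.exp (-(3 / 2 + 2 * η) * r) = y at h1 ⊢
            rw [hL₂, eq_div_iff hsq.ne']
            field_simp
            linear_combination -h1)
  have h₃ := hout (fun r => (r ^ 2 / (Real.sinh r * Real.sqrt (Real.cosh r - Real.cosh ρ))) *
      ∫ t in Set.Ioi (0 : ℝ), t ^ (-3 : ℤ) * Real.exp (-(α + 9 / 4) * t - r ^ 2 / (4 * t)))
    L₃ ρ hL₃0.le hρ (by
      intro r hr
      have hr0 : 0 < r := hρ0.trans hr
      have hcosh : 0 < Real.cosh r - Real.cosh ρ :=
        sub_pos.2 (Real.cosh_lt_cosh.2 (by rwa [abs_of_pos hρ0, abs_of_pos hr0]))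
      have hsq := Real.sqrt_pos.2 hcosh
      have hs := hsinh r (hρ.trans hr.le)
      have hs0 : 0 < Real.sinh r := Real.sinh_pos_iff.2 hr0
      rw [abs_mul, abs_of_nonneg (by positivity :
        0 ≤ r ^ 2 / (Real.sinh r * Real.sqrt (Real.cosh r - Real.cosh ρ)))]
      calc r ^ 2 / (Real.sinh r * Real.sqrt (Real.cosh r - Real.cosh ρ)) * _
          ≤ 2 / η ^ 2 * Real.exp (η * r) /
            (c * Real.exp r * Real.sqrt (Real.cosh r - Real.cosh ρ)) *
            (K₃ * Real.exp (-(3 / 2 + 2 * η) * r)) := by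
            have := hin₃ r (hρ.trans hr.le)
            have := sq_le_mul_exp hη hr0.le
            gcongr
            assumption
        _ = L₃ * Real.exp (-(5 / 2 + η) * r) / Real.sqrt (Real.cosh r - Real.cosh ρ) := by
            have h1 : Real.exp (-(5 / 2 + η) * r) * Real.exp r =
                Real.exp (η * r) * Real.exp (-(3 / 2 + 2 * η) * r) := by
              rw [← Real.exp_add, ← Real.exp_add]
              congr 1
              ring
            generalize Real.exp (-(5 / 2 + η) * r) = x at h1 ⊢
            generalize Real.exp (-(3 / 2 + 2 * η) * r) = y at h1 ⊢
            rw [hL₃, eq_div_iff hsq.ne']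
            field_simp
            linear_combination -h1)
  rw [hexp] at h₂ h₃
  unfold Gahalf
  refine (abs_add_le _ _).trans ?_
  rw [abs_mul, abs_mul, abs_of_pos hA0, abs_of_pos hB0]
  have := mul_le_mul_of_nonneg_left h₂ hA0.le
  have := mul_le_mul_of_nonneg_left h₃ hB0.le
  linarith

/-- An upper bound for the hyperbolic volume of a centered ball of Euclidean radius `r`. -/
lemma hypVol_ball_le {r : ℝ} (hr0 : 0 ≤ r) (hr1 : r < 1) :
    hypVol (Metric.ball 0 r) ≤ ENNReal.ofReal (8 * π ^ 2 * (r ^ 4 / (1 - r ^ 2) ^ 3)) := by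
  have hpos : ∀ s ∈ Set.Icc 0 r, 0 < 1 - s ^ 2 := fun s hs => by nlinarith [hs.1, hs.2]
  set w : ℝ → ℝ := fun s => (2 / (1 - s ^ 2)) ^ 4 with hw
  have hwcont : ContinuousOn w (Set.Icc 0 r) :=
    (continuousOn_const.div (by fun_prop) fun s hs => (hpos s hs).ne').pow 4
  have hint1 : IntegrableOn (fun s => s ^ 3 * w s) (Set.Icc 0 r) :=
    ContinuousOn.integrableOn_Icc ((by fun_prop : ContinuousOn (fun s : ℝ => s ^ 3) _).mul hwcont)
  have hdim : Module.finrank ℝ E4 = 4 := by simp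
  have hint : IntegrableOn (fun x : E4 => w ‖x‖) (Metric.ball 0 r) := by
    rw [integrableOn_fun_norm_addHaar volume, hdim]
    exact hint1.mono_set Set.Ioo_subset_Icc_self
  have hvol : (volume : Measure E4).real (Metric.ball 0 1) = π ^ 2 / 2 := by
    rw [Measure.real, InnerProductSpace.volume_ball_of_dim_even (k := 2) (by rw [hdim])]
    simp [ENNReal.toReal_ofReal (by positivity : 0 ≤ π ^ 2 / 2)]
  have hval : ∫ x in Metric.ball (0 : E4) r, w ‖x‖ ≤ 8 * π ^ 2 * (r ^ 4 / (1 - r ^ 2) ^ 3) := by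
    have hpolar : ∫ x in Metric.ball (0 : E4) r, w ‖x‖ =
        2 * π ^ 2 * ∫ s in (0 : ℝ)..r, s ^ 3 * w s := by
      have hind : (Metric.ball (0 : E4) r).indicator (fun x => w ‖x‖) =
          fun x => (Set.Iio r).indicator w ‖x‖ := by
        ext x
        by_cases hx : ‖x‖ < r
        · rw [Set.indicator_of_mem (mem_ball_zero_iff.2 hx), Set.indicator_of_mem (Set.mem_Iio.2 hx)]
        · rw [Set.indicator_of_notMem (mem_ball_zero_iff.not.2 hx),
            Set.indicator_of_notMem (Set.mem_Iio.not.2 hx)]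
      have hind' : (fun s : ℝ => s ^ 3 • (Set.Iio r).indicator w s) =
          (Set.Iio r).indicator fun s => s ^ 3 * w s := by
        ext s
        simp [Set.indicator_apply]
      rw [← integral_indicator Metric.isOpen_ball.measurableSet, hind,
        integral_fun_norm_addHaar volume, hdim, hvol, hind',
        setIntegral_indicator measurableSet_Iio, Set.Ioi_inter_Iio,
        intervalIntegral.integral_of_le hr0, integral_Ioc_eq_integral_Ioo, nsmul_eq_mul, smul_eq_mul]
      push_cast
      ring
    have hderiv : ∀ s ∈ Set.uIcc 0 r, HasDerivAt (fun s : ℝ => 4 * s ^ 4 / (1 - s ^ 2) ^ 3)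
        ((16 * s ^ 3 + 8 * s ^ 5) / (1 - s ^ 2) ^ 4) s := by
      intro s hs
      rw [Set.uIcc_of_le hr0] at hs
      have hne := (hpos s hs).ne'
      refine (((hasDerivAt_pow 4 s).const_mul 4).div
        (((hasDerivAt_pow 2 s).const_sub 1).pow 3) (pow_ne_zero 3 hne)).congr_deriv ?_
      simp only [Pi.pow_apply]
      field_simp
      push_cast
      ring
    have hcont : ContinuousOn (fun s : ℝ => (16 * s ^ 3 + 8 * s ^ 5) / (1 - s ^ 2) ^ 4)
        (Set.Icc 0 r) :=
      ContinuousOn.div (by fun_prop) (by fun_prop) fun s hs => pow_ne_zero 4 (hpos s hs).ne'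
    have hint2 := hcont.intervalIntegrable_of_Icc (μ := volume) hr0
    have hftc := intervalIntegral.integral_eq_sub_of_hasDerivAt hderiv hint2
    have hmono := intervalIntegral.integral_mono_on hr0
      ((intervalIntegrable_iff_integrableOn_Icc_of_le hr0).2 hint1) hint2 fun s hs => by
        have h0 := hpos s hs
        have h1 := pow_nonneg hs.1 5
        simp only [hw]
        rw [div_pow, ← mul_div_assoc]
        gcongr
        linarith
    rw [hftc] at hmono
    rw [hpolar]
    calc _ ≤ 2 * π ^ 2 * _ := mul_le_mul_of_nonneg_left hmono (by positivity)
      _ = _ := by ring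
  have hsub : Metric.ball (0 : E4) r ⊆ Metric.ball 0 1 := Metric.ball_subset_ball hr1.le
  rw [hypVol, withDensity_apply _ Metric.isOpen_ball.measurableSet, Measure.restrict_restrict
    Metric.isOpen_ball.measurableSet, Set.inter_eq_left.2 hsub,
    ← ofReal_integral_eq_lintegral_ofReal hint
      (Filter.Eventually.of_forall fun x => by simp only [hw]; positivity)]
  exact ENNReal.ofReal_le_ofReal hval

lemma hypVol_compl_ball : hypVol (Metric.ball 0 1)ᶜ = 0 := by
  refine withDensity_absolutelyContinuous _ _ ?_
  rw [Measure.restrict_apply Metric.isOpen_ball.measurableSet.compl, Set.compl_inter_self,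
    measure_empty]

lemma rearr_le {f : E4 → ℝ} {s t : ℝ} (hs : 0 < s)
    (h : hypVol {x : E4 | s < |f x|} ≤ ENNReal.ofReal t) : rearr f t ≤ s :=
  csInf_le ⟨0, fun _ hu => hu.1.le⟩ ⟨hs, h⟩

theorem Gahalf_rearrangement_estimate (α : ℝ) (hα : 0 < α) :
    ∃ δ C : ℝ, 0 < δ ∧ 0 < C ∧ ∀ t : ℝ, 2 < t →
      rearr (fun x => Gahalf α (rhyp x)) t ≤ C * t ^ (-1 - δ) := by
  obtain ⟨η, K, hη, hK, hdecay⟩ := Gahalf_decay hα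
    (Real.log_pos (show (1 : ℝ) < 1 + 1 / 100 by norm_num))
  refine ⟨η / 3, K * 100 ^ (3 + η), by positivity, by positivity, fun t ht => ?_⟩
  have ht0 : 0 < t := by linarith
  obtain ⟨u, hu, hut⟩ : ∃ u : ℝ, 1 ≤ u ∧ t = u ^ 3 := by
    refine ⟨t ^ (1 / 3 : ℝ), Real.one_le_rpow (by linarith) (by norm_num), ?_⟩
    rw [← Real.rpow_natCast, ← Real.rpow_mul ht0.le]
    norm_num
  have hu0 : 0 < u := by linarith
  have hpow : t ^ (-1 - η / 3) = u ^ (-(3 + η)) := by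
    rw [hut, ← Real.rpow_natCast u 3, ← Real.rpow_mul hu0.le]
    congr 1
    push_cast
    ring
  set w := u / 100 with hw
  have hw0 : 0 < w := by positivity
  have hCs : K * 100 ^ (3 + η) * t ^ (-1 - η / 3) = K * w ^ (-(3 + η)) := by
    rw [hpow, hw, Real.div_rpow hu0.le (by norm_num), Real.rpow_neg (by norm_num : (0 : ℝ) ≤ 100)]
    field_simp
  set r := Real.sqrt (w / (1 + w)) with hr
  have hr2 : r ^ 2 = w / (1 + w) := Real.sq_sqrt (by positivity)
  have hr1 : r < 1 := by
    rw [hr, Real.sqrt_lt' one_pos, div_lt_iff₀ (by positivity)]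
    linarith
  rw [hCs]
  refine rearr_le (by positivity) ?_
  have hsub : {x : E4 | K * w ^ (-(3 + η)) < |Gahalf α (rhyp x)|} ⊆
      Metric.ball 0 r ∪ (Metric.ball 0 1)ᶜ := by
    intro x hx
    by_contra hcon
    simp only [Set.mem_union, Set.mem_compl_iff, mem_ball_zero_iff, not_or, not_lt]
      at hcon
    obtain ⟨hxr, hx1⟩ := hcon
    have hexp : 1 + w ≤ (1 + ‖x‖) / (1 - ‖x‖) := by
      have h1 : w / (1 + w) ≤ ‖x‖ ^ 2 := by
        rw [← hr2]
        gcongr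
      rw [div_le_iff₀ (by positivity)] at h1
      rw [le_div_iff₀ (by linarith)]
      have h2 : ‖x‖ ^ 2 ≤ ‖x‖ := by nlinarith [norm_nonneg x]
      nlinarith [norm_nonneg x]
    have hlog : Real.log (1 + w) ≤ rhyp x := Real.log_le_log (by positivity) hexp
    have hlog0 : Real.log (1 + 1 / 100) ≤ rhyp x :=
      (Real.log_le_log (by norm_num) (by rw [hw]; linarith)).trans hlog
    refine absurd hx (not_lt.2 ((hdecay _ hlog0).trans ?_))
    gcongr
    rw [Real.rpow_def_of_pos hw0, Real.exp_le_exp]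
    have h3 : Real.log w ≤ rhyp x := (Real.log_le_log hw0 (by linarith)).trans hlog
    nlinarith
  refine (measure_mono hsub).trans ((measure_union_le _ _).trans ?_)
  rw [hypVol_compl_ball, add_zero]
  refine (hypVol_ball_le (Real.sqrt_nonneg _) hr1).trans (ENNReal.ofReal_le_ofReal ?_)
  have hvol : r ^ 4 / (1 - r ^ 2) ^ 3 = w ^ 2 * (1 + w) := by
    rw [show r ^ 4 = (r ^ 2) ^ 2 by ring, hr2, show 1 - w / (1 + w) = 1 / (1 + w) by
      field_simp; ring]
    field_simp
  have hπ : π ^ 2 < 10 := by nlinarith [Real.pi_lt_d2, Real.pi_pos]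
  rw [hvol, hut, hw]
  have h1 : (u / 100) ^ 2 * (1 + u / 100) ≤ u ^ 3 * (2 / 10000) := by nlinarith [pow_pos hu0 2]
  have h2 : 0 ≤ (u / 100) ^ 2 * (1 + u / 100) := by positivity
  nlinarith [pow_pos hu0 3]
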